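/- arXiv:2301.01803 — 4 statements merged into one kernel-verified Lean document; each statement's English description precedes it below -/
import Mathlib

section
/- Let A = [[a,b],[c,d]] be a real 2×2 matrix with ad−bc=1, let B = [[d,b],[c,a]], and assume trace(A·B) ≠ 2 and trace(A·B) ≠ −2. Then the real Krein signs of A·B and B·A differ (i.e. sign of the upper-right entry of A·B is not equal to sign of the upper-right entry of B·A) if and only if trace(A·B) < −2, i.e. if and only if A·B (and hence also B·A) is negative hyperbolic. -/
/-- For `A = !![a,b;c,d]` with `a*d - b*c = 1`, `B = !![d,b;c,a]`,
and `trace (A*B) ≠ ±2`, the real Krein signs of `A*B` and `B*A` (the signs of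
their upper-right entries) differ if and only if `trace (A*B) < -2`, i.e. iff
`A*B` (and hence `B*A`) is negative hyperbolic. -/
theorem doubly_symmetric_stmt6 (a b c d : ℝ) (hA : a * d - b * c = 1)
    (A B : Matrix (Fin 2) (Fin 2) ℝ)
    (hAdef : A = !![a, b; c, d]) (hBdef : B = !![d, b; c, a])
    (htr2 : Matrix.trace (A * B) ≠ 2) (htr2' : Matrix.trace (A * B) ≠ -2) :
    Real.sign ((A * B) 0 1) ≠ Real.sign ((B * A) 0 1) ↔
      Matrix.trace (A * B) < -2 := by
  subst hAdef hBdef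
  simp only [Matrix.trace_fin_two, Matrix.mul_apply, Fin.sum_univ_two, Matrix.of_apply,
    Matrix.cons_val_zero, Matrix.cons_val_one, Matrix.cons_val', Matrix.cons_val_fin_one]
    at htr2 htr2' ⊢
  have hb : b ≠ 0 := by
    rintro rfl
    exact htr2 (by linarith)
  have ha : a ≠ 0 := by
    rintro rfl
    exact htr2' (by linarith)
  have hd : d ≠ 0 := by
    rintro rfl
    exact htr2' (by linarith)
  have htrace : a * d + b * c + (c * b + d * a) < -2 ↔ a * d < 0 := by
    constructor <;> intro h <;> linarith
  have hab : a * b + b * a = 2 * (a * b) := by ring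
  have hdb : d * b + b * d = 2 * (d * b) := by ring
  rw [htrace, hab, hdb]
  rcases ha.lt_or_gt with ha | ha <;> rcases hb.lt_or_gt with hb | hb <;>
    rcases hd.lt_or_gt with hd | hd <;>
    norm_num [Real.sign, mul_neg_iff, mul_pos_iff, ha, hb, hd, ha.not_gt, hb.not_gt, hd.not_gt]
end

section
/- Let A, B ∈ SL(2,ℝ) with R·A·R = B⁻¹ where R = diag(1,−1), and suppose there exists a real 2×2 matrix S with S² = Id, det(S) = −1 (i.e. S antisymplectic for the standard symplectic form on ℝ²), R·S·R = S, S·A·S = A⁻¹ and S·B⁻¹·S = B. Then neither A·B nor B·A is negative hyperbolic, i.e. trace(A·B) ≥ −2 and trace(B·A) ≥ −2. -/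
/-- The trace of the square of a real `2×2` matrix of determinant one is at least `-2`. -/
theorem neg_two_le_trace_mul_self {A : Matrix (Fin 2) (Fin 2) ℝ} (hA : A.det = 1) :
    -2 ≤ Matrix.trace (A * A) := by
  rw [Matrix.det_fin_two] at hA
  simp only [Matrix.trace_fin_two, Matrix.mul_apply, Fin.sum_univ_two]
  nlinarith [sq_nonneg (A 0 0 + A 1 1)]

/-- A matrix commuting with `diag(1,-1)`, squaring to one and of determinant `-1`
acts by conjugation in the same way as `diag(1,-1)`. -/
theorem conj_eq_conj_reflection {S : Matrix (Fin 2) (Fin 2) ℝ}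
    (hS2 : S * S = 1) (hSdet : S.det = -1)
    (hRSR : !![1, 0; 0, -1] * S * !![1, 0; 0, -1] = S) (A : Matrix (Fin 2) (Fin 2) ℝ) :
    S * A * S = !![1, 0; 0, -1] * A * !![1, 0; 0, -1] := by
  have h01 : S 0 1 = 0 := by
    have h := congrFun₂ hRSR 0 1
    simp [Matrix.mul_apply, Matrix.vecMul, dotProduct, Fin.sum_univ_two] at h
    linarith
  have h10 : S 1 0 = 0 := by
    have h := congrFun₂ hRSR 1 0
    simp [Matrix.mul_apply, Matrix.vecMul, dotProduct, Fin.sum_univ_two] at h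
    linarith
  have h00 : S 0 0 * S 0 0 = 1 := by
    simpa [Matrix.mul_apply, Fin.sum_univ_two, h01] using congrFun₂ hS2 0 0
  have h11 : S 1 1 * S 1 1 = 1 := by
    simpa [Matrix.mul_apply, Fin.sum_univ_two, h10] using congrFun₂ hS2 1 1
  have hd : S 0 0 * S 1 1 = -1 := by
    simpa [Matrix.det_fin_two, h01] using hSdet
  ext i j
  fin_cases i <;> fin_cases j <;>
    simp [Matrix.mul_apply, Matrix.vecMul, dotProduct, Fin.sum_univ_two, h01, h10]
  · linear_combination A 0 0 * h00
  · linear_combination A 0 1 * hd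
  · linear_combination A 1 0 * hd
  · linear_combination A 1 1 * h11


/-- If `(A,B)` is a real couple of `SL(2,ℝ)` matrices with respect
to `R = diag(1,-1)` (i.e. `R*A*R = B⁻¹`), which is symmetric via an
antisymplectic matrix `S` (`S^2 = 1`, `det S = -1`, `R*S*R = S`, `S*A*S = A⁻¹`,
`S*B⁻¹*S = B`), then neither `A*B` nor `B*A` is negative hyperbolic:
`trace (A*B) ≥ -2` and `trace (B*A) ≥ -2`. -/
theorem doubly_symmetric_stmt9 (R A B S : Matrix (Fin 2) (Fin 2) ℝ)
    (hR : R = !![1, 0; 0, -1]) (hAdet : A.det = 1) (hBdet : B.det = 1)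
    (hcouple : R * A * R = B⁻¹)
    (hS2 : S * S = 1) (hSdet : S.det = -1) (hRSR : R * S * R = S)
    (hSA : S * A * S = A⁻¹) (hSB : S * B⁻¹ * S = B) :
    -2 ≤ Matrix.trace (A * B) ∧ -2 ≤ Matrix.trace (B * A) := by
  subst hR
  have hAB : A⁻¹ = B⁻¹ := by
    rw [← hSA, conj_eq_conj_reflection hS2 hSdet hRSR, hcouple]
  have hBA : B = A := by
    rw [← Matrix.nonsing_inv_nonsing_inv B (by simp [hBdet]), ← hAB,
      Matrix.nonsing_inv_nonsing_inv A (by simp [hAdet])]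
  subst hBA
  exact ⟨neg_two_le_trace_mul_self hAdet, neg_two_le_trace_mul_self hAdet⟩
end

section
/- Let E = ℝⁿ, let X : E → E be a locally Lipschitz vector field, let τ > 0, and let ρ₁, ρ₂ : E → E be continuously differentiable commuting involutions (ρᵢ∘ρᵢ = id, ρ₁∘ρ₂ = ρ₂∘ρ₁) satisfying the anti-invariance X(ρᵢ(x)) = −Dρᵢ(x)·X(x) for all x ∈ E and i = 1,2. Let v : ℝ → E be a 1-periodic solution of v'(t) = τ·X(v(t)) which is symmetric with respect to ρ₁, i.e. ρ₁(v(−t)) = v(t) for all t, and doubly symmetric with respect to ρ₂, i.e. ρ₂(v(0)) = v(1/2). Then the reparametrized orbit w(t) := v(t + 1/4) is symmetric with respect to ρ₂ (ρ₂(w(−t)) = w(t) for all t) and doubly symmetric with respect to ρ₁ (ρ₁(w(0)) = w(1/2)). -/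
open scoped Topology

/-- Global uniqueness of solutions of an autonomous ODE with locally Lipschitz right-hand side. -/
theorem LocallyLipschitz.eq_of_hasDerivAt {E : Type*} [NormedAddCommGroup E] [NormedSpace ℝ E]
    {Y : E → E} (hY : LocallyLipschitz Y) {f g : ℝ → E}
    (hf : ∀ t, HasDerivAt f (Y (f t)) t) (hg : ∀ t, HasDerivAt g (Y (g t)) t)
    {t₀ : ℝ} (h₀ : f t₀ = g t₀) : f = g := by
  have hfc : Continuous f := continuous_iff_continuousAt.2 fun t => (hf t).continuousAt
  have hgc : Continuous g := continuous_iff_continuousAt.2 fun t => (hg t).continuousAt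
  have hopen : IsOpen {t | f t = g t} := by
    rw [isOpen_iff_mem_nhds]
    intro t ht
    obtain ⟨K, s, hs, hK⟩ := hY (f t)
    have hfs : ∀ᶠ r in 𝓝 t, f r ∈ s := hfc.continuousAt.eventually_mem hs
    have hgs : ∀ᶠ r in 𝓝 t, g r ∈ s :=
      hgc.continuousAt.eventually_mem (by rwa [← show f t = g t from ht])
    exact ODE_solution_unique_of_eventually (v := fun _ => Y) (s := fun _ => s)
      (Filter.Eventually.of_forall fun _ => hK)
      (hfs.mono fun r hr => ⟨hf r, hr⟩) (hgs.mono fun r hr => ⟨hg r, hr⟩) ht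
  have huniv : {t | f t = g t} = Set.univ :=
    IsClopen.eq_univ ⟨isClosed_eq hfc hgc, hopen⟩ ⟨t₀, h₀⟩
  exact funext fun t => Set.eq_univ_iff_forall.1 huniv t

/-- A differentiable map under which `X` is anti-invariant sends time-reversed
solutions of `v' = τ • X v` to solutions. -/
theorem HasDerivAt.comp_const_sub_of_antiInvariant {E : Type*} [NormedAddCommGroup E]
    [NormedSpace ℝ E] {X ρ : E → E} {τ : ℝ} {v : ℝ → E} (hρ : Differentiable ℝ ρ)
    (hanti : ∀ x, X (ρ x) = -(fderiv ℝ ρ x (X x)))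
    (hode : ∀ t, HasDerivAt v (τ • X (v t)) t) (c t : ℝ) :
    HasDerivAt (fun r => ρ (v (c - r))) (τ • X (ρ (v (c - t)))) t := by
  have hv : HasDerivAt (fun r => v (c - r)) (-(τ • X (v (c - t)))) t :=
    (hode (c - t)).comp_const_sub c t
  have hcomp := (hρ (v (c - t))).hasFDerivAt.comp_hasDerivAt t hv
  simpa [hanti, Function.comp_def] using hcomp


/-- Let `X : ℝⁿ → ℝⁿ` be locally Lipschitz, `τ > 0`, and let
`ρ₁, ρ₂` be C¹ commuting involutions with `X(ρᵢ(x)) = -Dρᵢ(x)·X(x)`.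
If `v` is a 1-periodic solution of `v' = τ·X(v)` which is symmetric with
respect to `ρ₁` (`ρ₁(v(-t)) = v(t)`) and doubly symmetric with respect to `ρ₂`
(`ρ₂(v(0)) = v(1/2)`), then the shifted orbit `w(t) = v(t + 1/4)` is symmetric
with respect to `ρ₂` and doubly symmetric with respect to `ρ₁`. -/
theorem doubly_symmetric_stmt14 (n : ℕ)
    (X : EuclideanSpace ℝ (Fin n) → EuclideanSpace ℝ (Fin n))
    (hX : LocallyLipschitz X) (τ : ℝ) (hτ : 0 < τ)
    (ρ₁ ρ₂ : EuclideanSpace ℝ (Fin n) → EuclideanSpace ℝ (Fin n))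
    (hρ₁C : ContDiff ℝ 1 ρ₁) (hρ₂C : ContDiff ℝ 1 ρ₂)
    (hρ₁inv : ∀ x, ρ₁ (ρ₁ x) = x) (hρ₂inv : ∀ x, ρ₂ (ρ₂ x) = x)
    (hcomm : ∀ x, ρ₁ (ρ₂ x) = ρ₂ (ρ₁ x))
    (hanti₁ : ∀ x, X (ρ₁ x) = -(fderiv ℝ ρ₁ x (X x)))
    (hanti₂ : ∀ x, X (ρ₂ x) = -(fderiv ℝ ρ₂ x (X x)))
    (v : ℝ → EuclideanSpace ℝ (Fin n))
    (hper : ∀ t, v (t + 1) = v t)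
    (hode : ∀ t, HasDerivAt v (τ • X (v t)) t)
    (hsym : ∀ t, ρ₁ (v (-t)) = v t)
    (hdsym : ρ₂ (v 0) = v (1 / 2)) :
    (∀ t, ρ₂ (v (-t + 1 / 4)) = v (t + 1 / 4)) ∧
      ρ₁ (v (0 + 1 / 4)) = v (1 / 2 + 1 / 4) := by
  have hY : LocallyLipschitz fun x => τ • X x := by
    intro x
    obtain ⟨K, s, hs, hK⟩ := hX x
    exact ⟨_, s, hs, (lipschitzWith_smul τ).comp_lipschitzOnWith hK⟩
  have hreflect : (fun t => ρ₂ (v (1 / 2 - t))) = v :=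
    hY.eq_of_hasDerivAt (t₀ := 1 / 2)
      (HasDerivAt.comp_const_sub_of_antiInvariant (hρ₂C.differentiable one_ne_zero)
        hanti₂ hode (1 / 2)) hode (by simpa using hdsym)
  refine ⟨fun t => ?_, ?_⟩
  · rw [← congrFun hreflect (t + 1 / 4)]
    ring_nf
  · rw [← hsym (1 / 2 + 1 / 4), ← hper (-(1 / 2 + 1 / 4))]
    norm_num
end

section
/- Let E = ℝⁿ, let X : E → E be a locally Lipschitz vector field, let τ > 0, and let ρ₁, ρ₂ : E → E be continuously differentiable commuting involutions satisfying X(ρᵢ(x)) = −Dρᵢ(x)·X(x) for all x and i = 1,2. Let v : ℝ → E be a 1-periodic solution of v'(t) = τ·X(v(t)) such that the shifted orbit w(t) := v(t + 1/4) is symmetric with respect to ρ₂ (ρ₂(w(−t)) = w(t) for all t) and doubly symmetric with respect to ρ₁ (ρ₁(w(0)) = w(1/2)). Then v itself is symmetric with respect to ρ₁ (ρ₁(v(−t)) = v(t) for all t) and doubly symmetric with respect to ρ₂ (ρ₂(v(0)) = v(1/2)). -/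
/-- Two global solutions of an autonomous ODE with locally Lipschitz right-hand side that agree at
one time agree everywhere. -/
theorem eq_of_hasDerivAt_of_locallyLipschitz {E : Type*} [NormedAddCommGroup E] [NormedSpace ℝ E]
    {Y : E → E} (hY : LocallyLipschitz Y) {f g : ℝ → E}
    (hf : ∀ t, HasDerivAt f (Y (f t)) t) (hg : ∀ t, HasDerivAt g (Y (g t)) t)
    {t₀ : ℝ} (heq : f t₀ = g t₀) : f = g := by
  have hfc : Continuous f := continuous_iff_continuousAt.2 fun t => (hf t).continuousAt
  have hgc : Continuous g := continuous_iff_continuousAt.2 fun t => (hg t).continuousAt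
  have hopen : IsOpen {t | f t = g t} := by
    refine isOpen_iff_mem_nhds.2 fun t (hfg : f t = g t) => ?_
    obtain ⟨K, s, hs, hK⟩ := hY (f t)
    have hfs : ∀ᶠ u in nhds t, f u ∈ s := hfc.continuousAt.eventually_mem hs
    have hgs : ∀ᶠ u in nhds t, g u ∈ s :=
      hgc.continuousAt.eventually_mem (by rwa [← hfg])
    exact ODE_solution_unique_of_eventually (v := fun _ => Y) (s := fun _ => s) (K := K)
      (Filter.Eventually.of_forall fun _ => hK)
      (hfs.mono fun u hu => ⟨hf u, hu⟩) (hgs.mono fun u hu => ⟨hg u, hu⟩) hfg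
  have huniv : {t | f t = g t} = Set.univ :=
    IsClopen.eq_univ ⟨isClosed_eq hfc hgc, hopen⟩ ⟨t₀, heq⟩
  exact funext fun t => Set.eq_univ_iff_forall.1 huniv t

/-- An anti-invariant involution maps solutions to time-reversed solutions. -/
theorem hasDerivAt_comp_neg_of_antiInvariant {E : Type*} [NormedAddCommGroup E] [NormedSpace ℝ E]
    {X ρ : E → E} (hρ : Differentiable ℝ ρ) (hanti : ∀ x, X (ρ x) = -(fderiv ℝ ρ x (X x)))
    {τ : ℝ} {v : ℝ → E} (hode : ∀ t, HasDerivAt v (τ • X (v t)) t) (t : ℝ) :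
    HasDerivAt (fun s => ρ (v (-s))) (τ • X (ρ (v (-t)))) t := by
  have hv : HasDerivAt (fun s => v (-s)) (-(τ • X (v (-t)))) t := by
    simpa [Function.comp_def] using (hode (-t)).scomp t (hasDerivAt_neg t)
  have h := (hρ (v (-t))).hasFDerivAt.comp_hasDerivAt t hv
  simpa [Function.comp_def, hanti] using h

/-- Let `X : ℝⁿ → ℝⁿ` be locally Lipschitz, `τ > 0`, and let
`ρ₁, ρ₂` be C¹ commuting involutions with `X(ρᵢ(x)) = -Dρᵢ(x)·X(x)`.
If `v` is a 1-periodic solution of `v' = τ·X(v)` such that the shifted orbit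
`w(t) = v(t + 1/4)` is symmetric with respect to `ρ₂` (`ρ₂(w(-t)) = w(t)`) and
doubly symmetric with respect to `ρ₁` (`ρ₁(w(0)) = w(1/2)`), then `v` itself is
symmetric with respect to `ρ₁` (`ρ₁(v(-t)) = v(t)`) and doubly symmetric with
respect to `ρ₂` (`ρ₂(v(0)) = v(1/2)`). -/
theorem doubly_symmetric_stmt15 (n : ℕ)
    (X : EuclideanSpace ℝ (Fin n) → EuclideanSpace ℝ (Fin n))
    (hX : LocallyLipschitz X) (τ : ℝ) (hτ : 0 < τ)
    (ρ₁ ρ₂ : EuclideanSpace ℝ (Fin n) → EuclideanSpace ℝ (Fin n))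
    (hρ₁C : ContDiff ℝ 1 ρ₁) (hρ₂C : ContDiff ℝ 1 ρ₂)
    (hρ₁inv : ∀ x, ρ₁ (ρ₁ x) = x) (hρ₂inv : ∀ x, ρ₂ (ρ₂ x) = x)
    (hcomm : ∀ x, ρ₁ (ρ₂ x) = ρ₂ (ρ₁ x))
    (hanti₁ : ∀ x, X (ρ₁ x) = -(fderiv ℝ ρ₁ x (X x)))
    (hanti₂ : ∀ x, X (ρ₂ x) = -(fderiv ℝ ρ₂ x (X x)))
    (v : ℝ → EuclideanSpace ℝ (Fin n))
    (hper : ∀ t, v (t + 1) = v t)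
    (hode : ∀ t, HasDerivAt v (τ • X (v t)) t)
    (hwsym : ∀ t, ρ₂ (v (-t + 1 / 4)) = v (t + 1 / 4))
    (hwdsym : ρ₁ (v (0 + 1 / 4)) = v (1 / 2 + 1 / 4)) :
    (∀ t, ρ₁ (v (-t)) = v t) ∧ ρ₂ (v 0) = v (1 / 2) := by
  have hY : LocallyLipschitz fun x => τ • X x :=
    (lipschitzWith_smul τ).locallyLipschitz.comp hX
  have hbase : ρ₁ (v (-(-(1 / 4)))) = v (-(1 / 4)) := by
    rw [← hper (-(1 / 4))]
    convert hwdsym using 2 <;> norm_num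
  refine ⟨congrFun (eq_of_hasDerivAt_of_locallyLipschitz hY
    (hasDerivAt_comp_neg_of_antiInvariant (hρ₁C.differentiable one_ne_zero) hanti₁ hode)
    hode hbase), ?_⟩
  convert hwsym (1 / 4) using 2 <;> norm_num
end
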